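/- For every nonnegative integer i, lim_{n→∞} P(f⁺_{[0,n−1]}(R_n) = i) = lim_{n→∞} P(f⁺_{[0,⌊n/8⌋−1]}(R_n) = i), and likewise lim_{n→∞} P(f⁺_{[n,2n−2]}(R_n) = i) = lim_{n→∞} P(f⁺_{[(2n−2)−⌊n/8⌋+1,2n−2]}(R_n) = i); in particular, in either limit one exists if and only if the other does and then they are equal. -/

import Mathlib

open Finset Filter

open Classical in
/-- The number of missing sums of `R` in the integer interval `[a, b]`, i.e.
`#{k ∈ ℤ ∩ [a,b] : k ∉ R + R}` where `R + R = {x + y : x, y ∈ R}`. -/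
noncomputable def missSum (R : Finset ℕ) (a b : ℤ) : ℕ :=
  ((Finset.Icc a b).filter (fun k => ¬ ∃ x ∈ R, ∃ y ∈ R, (x : ℤ) + (y : ℤ) = k)).card

open Classical in
/-- The number of missing differences of `R` in the integer interval `[a, b]`, i.e.
`#{k ∈ ℤ ∩ [a,b] : k ∉ R - R}` where `R - R = {x - y : x, y ∈ R}`. -/
noncomputable def missDiff (R : Finset ℕ) (a b : ℤ) : ℕ :=
  ((Finset.Icc a b).filter (fun k => ¬ ∃ x ∈ R, ∃ y ∈ R, (x : ℤ) - (y : ℤ) = k)).card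

open Classical in
/-- The probability that the random set `R_n` — a subset of `{0,…,n-1}` in which each
element is included independently with probability `1/2`, i.e. a uniformly random
subset of `{0,…,n-1}` — satisfies the event `p`. -/
noncomputable def pR (n : ℕ) (p : Finset ℕ → Prop) : ℝ :=
  (((Finset.range n).powerset.filter p).card : ℝ) / 2 ^ n

open Classical in
/-- The probability that the random set `R_n'` — a uniformly random subset of
`{0,…,n-1}` conditioned on containing `0` — satisfies the event `p`. -/
noncomputable def pR' (n : ℕ) (p : Finset ℕ → Prop) : ℝ :=
  (((Finset.range n).powerset.filter (fun S => 0 ∈ S ∧ p S)).card : ℝ) / 2 ^ (n - 1)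

open Classical in
/-- The probability that the random set `R_n''` — a uniformly random subset of
`{0,…,n-1}` conditioned on containing both `0` and `n-1` — satisfies the event `p`. -/
noncomputable def pR'' (n : ℕ) (p : Finset ℕ → Prop) : ℝ :=
  (((Finset.range n).powerset.filter (fun S => 0 ∈ S ∧ n - 1 ∈ S ∧ p S)).card : ℝ) / 2 ^ (n - 2)

open Classical in
/-- The probability that the random set `R_∞` — a subset of `ℕ` in which each
nonnegative integer is included independently with probability `1/2` — satisfies the
event `p`, for an event `p` depending only on the elements `< N` of the set.  Since
each of the `2^N` possibilities for `R_∞ ∩ {0,…,N-1}` is equally likely and `p` is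
determined by this intersection, the probability is obtained by counting. -/
noncomputable def probInf (N : ℕ) (p : Finset ℕ → Prop) : ℝ :=
  (((Finset.range N).powerset.filter p).card : ℝ) / 2 ^ N

/-- The subsets of `U` containing no pair `{j, k - j}` with `j ∈ J`. -/
def pairAvoiding (k : ℕ) (U J : Finset ℕ) : Finset (Finset ℕ) :=
  U.powerset.filter (fun S => ∀ j ∈ J, ¬ (j ∈ S ∧ k - j ∈ S))

theorem pairAvoiding_insert_subset (k j : ℕ) (U J : Finset ℕ) :
    pairAvoiding k U (insert j J) ⊆
      pairAvoiding k ((U.erase j).erase (k - j)) J ∪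
        ((pairAvoiding k ((U.erase j).erase (k - j)) J).image (insert j) ∪
          (pairAvoiding k ((U.erase j).erase (k - j)) J).image (insert (k - j))) := by
  intro S hS
  simp only [pairAvoiding, mem_filter, mem_powerset, mem_insert, forall_eq_or_imp] at hS
  obtain ⟨hSU, hSj, hSJ⟩ := hS
  have hT : (S.erase j).erase (k - j) ∈ pairAvoiding k ((U.erase j).erase (k - j)) J := by
    simp only [pairAvoiding, mem_filter, mem_powerset]
    refine ⟨erase_subset_erase _ (erase_subset_erase _ hSU), fun i hi h => hSJ i hi ?_⟩
    exact ⟨mem_of_mem_erase (mem_of_mem_erase h.1), mem_of_mem_erase (mem_of_mem_erase h.2)⟩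
  simp only [mem_union, mem_image]
  by_cases h1 : j ∈ S
  · have h2 : k - j ∉ S := fun h => hSj ⟨h1, h⟩
    refine Or.inr (Or.inl ⟨_, hT, ?_⟩)
    rw [erase_eq_of_notMem (fun h => h2 (mem_of_mem_erase h)), insert_erase h1]
  · rw [erase_eq_of_notMem h1] at hT
    by_cases h2 : k - j ∈ S
    · exact Or.inr (Or.inr ⟨_, hT, insert_erase h2⟩)
    · rw [erase_eq_of_notMem h2] at hT
      exact Or.inl hT

theorem four_pow_mul_card_pairAvoiding_le (k : ℕ) (J : Finset ℕ) :
    ∀ U : Finset ℕ, (∀ j ∈ J, 2 * j < k ∧ j ∈ U ∧ k - j ∈ U) →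
      4 ^ #J * #(pairAvoiding k U J) ≤ 3 ^ #J * 2 ^ #U := by
  induction J using Finset.induction_on with
  | empty => intro U _; simp [pairAvoiding]
  | insert j J hjJ ih =>
    intro U h
    obtain ⟨⟨hj, hjU, hkU⟩, hJ⟩ := (forall_mem_insert _ _ _).1 h
    set V := (U.erase j).erase (k - j) with hV
    have hVcard : #U = #V + 2 := by
      have hmem : k - j ∈ U.erase j := mem_erase.2 ⟨by omega, hkU⟩
      rw [hV, ← card_erase_add_one hjU, ← card_erase_add_one hmem]
    have hstep : #(pairAvoiding k U (insert j J)) ≤ 3 * #(pairAvoiding k V J) := by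
      have h0 := card_le_card (pairAvoiding_insert_subset k j U J)
      rw [← hV] at h0
      have h1 := card_union_le (pairAvoiding k V J)
        ((pairAvoiding k V J).image (insert j) ∪ (pairAvoiding k V J).image (insert (k - j)))
      have h2 := card_union_le ((pairAvoiding k V J).image (insert j))
        ((pairAvoiding k V J).image (insert (k - j)))
      have h3 := card_image_le (s := pairAvoiding k V J) (f := insert j)
      have h4 := card_image_le (s := pairAvoiding k V J) (f := insert (k - j))
      omega
    have hrec := ih V (fun i hi => by
      obtain ⟨hik, hiU, hkiU⟩ := hJ i hi
      have hij : i ≠ j := fun e => hjJ (e ▸ hi)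
      refine ⟨hik, ?_, ?_⟩ <;> simp only [hV, mem_erase]
      · exact ⟨by omega, hij, hiU⟩
      · exact ⟨by omega, by omega, hkiU⟩)
    rw [card_insert_of_notMem hjJ, hVcard]
    calc 4 ^ (#J + 1) * #(pairAvoiding k U (insert j J))
        ≤ 4 ^ (#J + 1) * (3 * #(pairAvoiding k V J)) := Nat.mul_le_mul_left _ hstep
      _ = 12 * (4 ^ #J * #(pairAvoiding k V J)) := by ring
      _ ≤ 12 * (3 ^ #J * 2 ^ #V) := Nat.mul_le_mul_left _ hrec
      _ = 3 ^ (#J + 1) * 2 ^ (#V + 2) := by ring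

theorem pR_mono {n : ℕ} {p q : Finset ℕ → Prop} (h : ∀ S ⊆ range n, p S → q S) :
    pR n p ≤ pR n q := by
  unfold pR
  gcongr 1
  exact_mod_cast card_le_card fun S hS => by
    simp only [mem_filter, mem_powerset] at hS ⊢
    exact ⟨hS.1, h S hS.1 hS.2⟩

theorem pR_or_le (n : ℕ) (p q : Finset ℕ → Prop) :
    pR n (fun S => p S ∨ q S) ≤ pR n p + pR n q := by
  classical
  unfold pR
  rw [← add_div]
  gcongr 1
  norm_cast
  convert card_union_le ((range n).powerset.filter p) ((range n).powerset.filter q) using 2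
  rw [← filter_or]
  congr

theorem pR_exists_mem_le (n : ℕ) (K : Finset ℕ) (p : ℕ → Finset ℕ → Prop) :
    pR n (fun S => ∃ k ∈ K, p k S) ≤ ∑ k ∈ K, pR n (p k) := by
  induction K using Finset.induction_on with
  | empty => simp [pR]
  | insert k K hk ih =>
    rw [sum_insert hk]
    calc pR n (fun S => ∃ i ∈ insert k K, p i S)
        ≤ pR n (fun S => p k S ∨ ∃ i ∈ K, p i S) :=
          pR_mono fun S _ h => by simpa using h
      _ ≤ _ := (pR_or_le n _ _).trans (by gcongr)

theorem abs_pR_sub_pR_le {n : ℕ} {p q b : Finset ℕ → Prop} (h : ∀ S, ¬ b S → (p S ↔ q S)) :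
    |pR n p - pR n q| ≤ pR n b := by
  have h1 : pR n p ≤ pR n q + pR n b :=
    (pR_mono fun S _ hS => by by_cases hb : b S <;> simp_all).trans (pR_or_le n q b)
  have h2 : pR n q ≤ pR n p + pR n b :=
    (pR_mono fun S _ hS => by by_cases hb : b S <;> simp_all).trans (pR_or_le n p b)
  rw [abs_le]
  constructor <;> linarith

/-- `k` is not a sum of two elements of `S`. -/
def IsMissingSum (S : Finset ℕ) (k : ℕ) : Prop := ¬ ∃ x ∈ S, ∃ y ∈ S, x + y = k

theorem pR_isMissingSum_le (n k : ℕ) :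
    pR n (fun S => IsMissingSum S k) ≤ (3 / 4 : ℝ) ^ ((k + 1) / 2 - (k + 1 - n)) := by
  classical
  set J := Ico (k + 1 - n) ((k + 1) / 2) with hJ
  have hcard : #J = (k + 1) / 2 - (k + 1 - n) := by simp [hJ]
  have hcount := four_pow_mul_card_pairAvoiding_le k J (range n) (fun j hj => by
    simp only [hJ, mem_Ico] at hj
    simp only [mem_range]
    omega)
  have hsub : (range n).powerset.filter (fun S => IsMissingSum S k) ⊆
      pairAvoiding k (range n) J := by
    intro S hS
    simp only [pairAvoiding, mem_filter] at hS ⊢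
    refine ⟨hS.1, fun j hj h => hS.2 ⟨j, h.1, k - j, h.2, ?_⟩⟩
    simp only [hJ, mem_Ico] at hj
    omega
  have hle : (4 : ℝ) ^ #J * #((range n).powerset.filter (fun S => IsMissingSum S k)) ≤
      3 ^ #J * 2 ^ n := by
    rw [card_range] at hcount
    exact_mod_cast (Nat.mul_le_mul_left _ (card_le_card hsub)).trans hcount
  rw [← hcard, pR, div_pow, div_le_div_iff₀ (by positivity) (by positivity)]
  rw [mul_comm]
  convert hle

/-- Some integer in the middle range `[n/8, 2n-2-n/8]` is not a sum of two elements of `S`. -/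
def HasMiddleMissingSum (n : ℕ) (S : Finset ℕ) : Prop :=
  ∃ k ∈ Icc (n / 8) (2 * n - 2 - n / 8), IsMissingSum S k

theorem pR_hasMiddleMissingSum_le {n : ℕ} (hn : 1 ≤ n) :
    pR n (HasMiddleMissingSum n) ≤ 32 * ((n / 16 : ℕ) + 1) * (3 / 4 : ℝ) ^ (n / 16) := by
  calc pR n (HasMiddleMissingSum n)
      ≤ ∑ k ∈ Icc (n / 8) (2 * n - 2 - n / 8), pR n (fun S => IsMissingSum S k) :=
        pR_exists_mem_le n _ fun k S => IsMissingSum S k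
    _ ≤ ∑ k ∈ Icc (n / 8) (2 * n - 2 - n / 8), (3 / 4 : ℝ) ^ (n / 16) := by
        refine sum_le_sum fun k hk => (pR_isMissingSum_le n k).trans ?_
        rw [mem_Icc] at hk
        exact pow_le_pow_of_le_one (by norm_num) (by norm_num) (by omega)
    _ = #(Icc (n / 8) (2 * n - 2 - n / 8)) * (3 / 4 : ℝ) ^ (n / 16) := by
        rw [sum_const, nsmul_eq_mul]
    _ ≤ _ := by
        gcongr
        rw [Nat.card_Icc]
        exact_mod_cast (by omega : 2 * n - 2 - n / 8 + 1 - n / 8 ≤ 32 * (n / 16 + 1))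

theorem tendsto_pR_hasMiddleMissingSum :
    Tendsto (fun n => pR n (HasMiddleMissingSum n)) atTop (nhds 0) := by
  have hlim : Tendsto (fun m : ℕ => 32 * ((m : ℝ) + 1) * (3 / 4 : ℝ) ^ m) atTop (nhds 0) := by
    have h1 := tendsto_self_mul_const_pow_of_lt_one (r := (3 / 4 : ℝ)) (by norm_num) (by norm_num)
    have h2 := tendsto_pow_atTop_nhds_zero_of_lt_one (r := (3 / 4 : ℝ)) (by norm_num) (by norm_num)
    convert (h1.add h2).const_mul 32 using 2 <;> ring
  refine squeeze_zero' (Eventually.of_forall fun n => by unfold pR; positivity) ?_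
    (hlim.comp (Nat.tendsto_div_const_atTop (n := 16) (by norm_num)))
  filter_upwards [eventually_ge_atTop 1] with n hn using pR_hasMiddleMissingSum_le hn

theorem missSum_eq_of_not_hasMiddleMissingSum {n : ℕ} {S : Finset ℕ}
    (hS : ¬ HasMiddleMissingSum n S) {a b c d : ℤ}
    (h : ∀ k : ℤ, ¬ ((n / 8 : ℕ) ≤ k ∧ k ≤ 2 * n - 2 - (n / 8 : ℕ)) →
      (a ≤ k ∧ k ≤ b ↔ c ≤ k ∧ k ≤ d)) :
    missSum S a b = missSum S c d := by
  unfold missSum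
  congr 1
  ext k
  simp only [mem_filter, mem_Icc]
  refine and_congr_left fun hk => h k fun hmid => hS ?_
  lift k to ℕ using by omega
  refine ⟨k, mem_Icc.2 (by omega), ?_⟩
  exact_mod_cast hk

theorem tendsto_pR_missSum_iff (i : ℕ) {a b c d : ℕ → ℤ}
    (h : ∀ᶠ n : ℕ in atTop, ∀ k : ℤ, ¬ ((n / 8 : ℕ) ≤ k ∧ k ≤ 2 * n - 2 - (n / 8 : ℕ)) →
      (a n ≤ k ∧ k ≤ b n ↔ c n ≤ k ∧ k ≤ d n)) (L : ℝ) :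
    Tendsto (fun n => pR n (fun S => missSum S (a n) (b n) = i)) atTop (nhds L) ↔
      Tendsto (fun n => pR n (fun S => missSum S (c n) (d n) = i)) atTop (nhds L) := by
  have hdiff : Tendsto (fun n => pR n (fun S => missSum S (a n) (b n) = i) -
      pR n (fun S => missSum S (c n) (d n) = i)) atTop (nhds 0) := by
    refine squeeze_zero_norm' ?_ tendsto_pR_hasMiddleMissingSum
    filter_upwards [h] with n hn
    exact abs_pR_sub_pR_le fun S hS => by
      rw [missSum_eq_of_not_hasMiddleMissingSum hS hn]
  constructor <;> intro hL
  · simpa using hL.sub hdiff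
  · simpa using hL.add hdiff

/-- For every nonnegative integer `i`,
`lim P(f⁺_{[0,n-1]}(R_n) = i) = lim P(f⁺_{[0,⌊n/8⌋-1]}(R_n) = i)` and
`lim P(f⁺_{[n,2n-2]}(R_n) = i) = lim P(f⁺_{[(2n-2)-⌊n/8⌋+1,2n-2]}(R_n) = i)`:
in either pair, one limit exists iff the other does, and then they are equal. -/
theorem limit_small_eq_extreme (i : ℕ) :
    (∀ L : ℝ,
      Tendsto (fun n : ℕ => pR n (fun S => missSum S 0 ((n : ℤ) - 1) = i)) atTop (nhds L) ↔
      Tendsto (fun n : ℕ => pR n (fun S => missSum S 0 (((n / 8 : ℕ) : ℤ) - 1) = i))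
        atTop (nhds L)) ∧
    (∀ L : ℝ,
      Tendsto (fun n : ℕ => pR n (fun S => missSum S (n : ℤ) (2 * (n : ℤ) - 2) = i))
        atTop (nhds L) ↔
      Tendsto (fun n : ℕ =>
          pR n (fun S => missSum S (2 * (n : ℤ) - 2 - ((n / 8 : ℕ) : ℤ) + 1) (2 * (n : ℤ) - 2) = i))
        atTop (nhds L)) := by
  refine ⟨tendsto_pR_missSum_iff i ?_, tendsto_pR_missSum_iff i ?_⟩ <;>
    filter_upwards [eventually_ge_atTop 2] with n hn k hk <;> omega
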